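/- Corollary (Hu): if players' cooperation choices are exchangeable under p (i.e., p(S) = p(S') whenever |S| = |S'|), then φ^p(v) = φ(v) for all coalitional games v on N, where φ is the Shapley value. -/

import Mathlib

open Finset

variable {n : ℕ}

/-- The set of players of `S` that precede `i` under the ordering `π`
(player `j` precedes `i` iff `π.symm j < π.symm i`). -/
def yesSet (π : Equiv.Perm (Fin n)) (S : Finset (Fin n)) (i : Fin n) : Finset (Fin n) :=
  S.filter (fun j => π.symm j < π.symm i)

/-- The set of players of `N ∖ S` that precede `i` under the ordering `π`. -/
def noSet (π : Equiv.Perm (Fin n)) (S : Finset (Fin n)) (i : Fin n) : Finset (Fin n) :=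
  Sᶜ.filter (fun j => π.symm j < π.symm i)

/-- The dual game `v*` of `v`:  `v*(T) = v(N) - v(N ∖ T)`. -/
noncomputable def dualGame (v : Finset (Fin n) → ℝ) (T : Finset (Fin n)) : ℝ :=
  v Finset.univ - v (Finset.univ \ T)

/-- The marginal contribution of player `i` in the roll call `(π, S)` for the game `v`. -/
noncomputable def marg (v : Finset (Fin n) → ℝ) (π : Equiv.Perm (Fin n)) (S : Finset (Fin n))
    (i : Fin n) : ℝ :=
  if i ∈ S then v (insert i (yesSet π S i)) - v (yesSet π S i)
  else dualGame v (insert i (noSet π S i)) - dualGame v (noSet π S i)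

/-- The generalized roll-call value `φ^p`. -/
noncomputable def phiP (p : Finset (Fin n) → ℝ) (v : Finset (Fin n) → ℝ) (i : Fin n) : ℝ :=
  (1 / (n.factorial : ℝ)) *
    ∑ π : Equiv.Perm (Fin n), ∑ S : Finset (Fin n), p S * marg v π S i

/-- The Shapley value (permutation formula), where the set of players preceding `i`
in the ordering `π` is `{j | π.symm j < π.symm i}`. -/
noncomputable def shapley (v : Finset (Fin n) → ℝ) (i : Fin n) : ℝ :=
  (1 / (n.factorial : ℝ)) *
    ∑ π : Equiv.Perm (Fin n),
      (v (insert i (Finset.univ.filter (fun j => π.symm j < π.symm i))) -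
        v (Finset.univ.filter (fun j => π.symm j < π.symm i)))

/-- Sorting key: positions in `A` first, in order, then the others in reverse order. -/
def rcKey (A : Finset (Fin n)) (j : Fin n) : ℕ :=
  if j ∈ A then j.val else 2 * n - j.val

lemma rcKey_injective (A : Finset (Fin n)) : Function.Injective (rcKey A) := by
  intro a b h
  have ha := a.isLt
  have hb := b.isLt
  unfold rcKey at h
  apply Fin.ext
  split_ifs at h <;> omega

lemma sort_symm_lt (A : Finset (Fin n)) (a b : Fin n) :
    (Tuple.sort (rcKey A)).symm a < (Tuple.sort (rcKey A)).symm b ↔ rcKey A a < rcKey A b := by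
  have hm : StrictMono (rcKey A ∘ Tuple.sort (rcKey A)) :=
    (Tuple.monotone_sort (rcKey A)).strictMono_of_injective
      ((rcKey_injective A).comp (Equiv.injective _))
  rw [← hm.lt_iff_lt]
  simp

lemma marg_eq_sorted (v : Finset (Fin n) → ℝ) (π : Equiv.Perm (Fin n)) (A : Finset (Fin n))
    (i : Fin n) :
    marg v π (A.map π.toEmbedding) i =
      v (insert i (Finset.univ.filter (fun j =>
        (π * Tuple.sort (rcKey A)).symm j < (π * Tuple.sort (rcKey A)).symm i))) -
      v (Finset.univ.filter (fun j =>
        (π * Tuple.sort (rcKey A)).symm j < (π * Tuple.sort (rcKey A)).symm i)) := by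
  have hs : ∀ j, (π * Tuple.sort (rcKey A)).symm j = (Tuple.sort (rcKey A)).symm (π.symm j) :=
    fun j => rfl
  have hmem : ∀ j, j ∈ A.map π.toEmbedding ↔ π.symm j ∈ A := by
    intro j
    exact Finset.mem_map_equiv
  simp only [hs, sort_symm_lt]
  unfold marg
  by_cases hi : i ∈ A.map π.toEmbedding
  · have hi' := (hmem i).1 hi
    have e : yesSet π (A.map π.toEmbedding) i =
        Finset.univ.filter (fun j => rcKey A (π.symm j) < rcKey A (π.symm i)) := by
      ext j
      simp only [yesSet, Finset.mem_filter, hmem, Finset.mem_univ, true_and, rcKey, hi', if_true]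
      have h1 := (π.symm j).isLt
      have h2 := (π.symm i).isLt
      split_ifs with h
      · simp [h]
      · simp only [h, false_and, false_iff]
        omega
    rw [if_pos hi, e]
  · have hi' : π.symm i ∉ A := fun h => hi ((hmem i).2 h)
    have key : ∀ j, j ∈ noSet π (A.map π.toEmbedding) i ↔
        rcKey A (π.symm i) < rcKey A (π.symm j) := by
      intro j
      simp only [noSet, Finset.mem_filter, Finset.mem_compl, hmem, rcKey, hi', if_false]
      have h1 := (π.symm j).isLt
      have h2 := (π.symm i).isLt
      split_ifs with h
      · simp only [h, not_true, false_and, false_iff]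
        omega
      · simp only [h, not_false_eq_true, true_and, Fin.lt_def]
        omega
    have hinj : ∀ j, rcKey A (π.symm j) = rcKey A (π.symm i) ↔ j = i := by
      intro j
      rw [(rcKey_injective A).eq_iff, π.symm.injective.eq_iff]
    have e1 : Finset.univ \ noSet π (A.map π.toEmbedding) i = insert i
        (Finset.univ.filter (fun j => rcKey A (π.symm j) < rcKey A (π.symm i))) := by
      ext j
      simp only [Finset.mem_sdiff, key, Finset.mem_insert, Finset.mem_filter, Finset.mem_univ,
        true_and, ← hinj j]
      omega
    have e2 : Finset.univ \ insert i (noSet π (A.map π.toEmbedding) i) =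
        Finset.univ.filter (fun j => rcKey A (π.symm j) < rcKey A (π.symm i)) := by
      ext j
      simp only [Finset.mem_sdiff, key, Finset.mem_insert, Finset.mem_filter, Finset.mem_univ,
        true_and, ← hinj j]
      omega
    rw [if_neg hi]
    unfold dualGame
    rw [e1, e2]
    ring

/-- Hu's corollary: if cooperation choices are exchangeable under `p`,
then `φ^p(v) = φ(v)` for all coalitional games `v`. -/
theorem phiP_eq_shapley_of_exchangeable (hn : 0 < n) (p : Finset (Fin n) → ℝ)
    (hp0 : ∀ S, 0 ≤ p S) (hp1 : ∑ S : Finset (Fin n), p S = 1)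
    (hex : ∀ S S' : Finset (Fin n), S.card = S'.card → p S = p S')
    (v : Finset (Fin n) → ℝ) (hv : v ∅ = 0) (i : Fin n) :
    phiP p v i = shapley v i := by
  unfold phiP shapley
  congr 1
  have h1 : ∀ π : Equiv.Perm (Fin n), ∑ S : Finset (Fin n), p S * marg v π S i =
      ∑ A : Finset (Fin n), p A * marg v π (A.map π.toEmbedding) i := by
    intro π
    rw [← Equiv.sum_comp (Equiv.finsetCongr π)]
    refine Finset.sum_congr rfl fun A _ => ?_
    rw [Equiv.finsetCongr_apply, hex (A.map π.toEmbedding) A (Finset.card_map _)]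
  simp only [h1]
  rw [Finset.sum_comm]
  simp only [← Finset.mul_sum, marg_eq_sorted]
  rw [← one_mul (∑ π : Equiv.Perm (Fin n),
      (v (insert i (Finset.univ.filter (fun j => π.symm j < π.symm i))) -
        v (Finset.univ.filter (fun j => π.symm j < π.symm i)))), ← hp1, Finset.sum_mul]
  refine Finset.sum_congr rfl fun A _ => ?_
  congr 1
  exact Equiv.sum_comp (Equiv.mulRight (Tuple.sort (rcKey A))) (fun π : Equiv.Perm (Fin n) =>
      v (insert i (Finset.univ.filter (fun j => π.symm j < π.symm i))) -
        v (Finset.univ.filter (fun j => π.symm j < π.symm i)))
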